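/- Let (X, Σ, μ) be a finite measure space, T > 0, and let φ : (0,T) × X × ℝ² → ℝ satisfy: (i) φ(t,·,ξ) is measurable for all t ∈ (0,T) and ξ ∈ ℝ², and φ(t,·,0) ∈ L¹(X,μ); (ii) φ(t,x,·) is locally Lipschitz on ℝ² for all t ∈ (0,T), x ∈ X; (iii) there is c > 0 such that every ν ∈ ∂φ(t,x,ξ) satisfies |ν|_{ℝ²} ≤ c(1 + |ξ|_{ℝ²}) for all t, x, ξ; (iv) there is d ≥ 0 such that φ°(t,x,ξ;−ξ) ≤ d(1 + |ξ|_{ℝ²}) for all t ∈ (0,T), x ∈ X, ξ ∈ ℝ². Let Φ(t,U) = ∫_X φ(t, x, U(x)) dμ(x) for U ∈ H := L²(X, μ; ℝ²). Then there exists d' > 0 such that for all t ∈ (0,T) and all U ∈ H, Φ°(t,U;−U) ≤ d'(1 + ‖U‖_H). -/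

import Mathlib

open MeasureTheory Filter

/-- The Clarke generalized directional derivative of `ψ` at `x` in direction `v`. -/
noncomputable def clarkeDeriv {E : Type*} [NormedAddCommGroup E] [NormedSpace ℝ E]
    (ψ : E → ℝ) (x v : E) : ℝ :=
  Filter.limsup (fun p : E × ℝ => (ψ (p.1 + p.2 • v) - ψ p.1) / p.2)
    ((nhds x) ×ˢ (nhdsWithin 0 (Set.Ioi (0 : ℝ))))

/-- The Clarke subdifferential `∂ψ(x) = {ξ ∈ E* : ⟨ξ,v⟩ ≤ ψ°(x;v) for all v ∈ E}`. -/
def clarkeSubdiff {E : Type*} [NormedAddCommGroup E] [NormedSpace ℝ E]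
    (ψ : E → ℝ) (x : E) : Set (E →L[ℝ] ℝ) :=
  {ξ | ∀ v : E, ξ v ≤ clarkeDeriv ψ x v}

lemma eventually_pos_nhds_prod {E : Type*} [TopologicalSpace E] (x : E) :
    ∀ᶠ p : E × ℝ in (nhds x) ×ˢ (nhdsWithin 0 (Set.Ioi (0 : ℝ))), 0 < p.2 :=
  tendsto_snd.eventually (eventually_mem_nhdsWithin (a := (0 : ℝ)) (s := Set.Ioi 0))

section Clarke

variable {E : Type*} [NormedAddCommGroup E] [NormedSpace ℝ E] {ψ : E → ℝ}

lemma tendsto_add_smul_nhds_prod (x v : E) :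
    Tendsto (fun p : E × ℝ => p.1 + p.2 • v)
      ((nhds x) ×ˢ (nhdsWithin 0 (Set.Ioi (0 : ℝ)))) (nhds x) := by
  have h : Tendsto (fun p : E × ℝ => p.1 + p.2 • v) (nhds (x, (0 : ℝ))) (nhds x) := by
    have : Continuous (fun p : E × ℝ => p.1 + p.2 • v) := by fun_prop
    simpa using this.tendsto (x, (0 : ℝ))
  rw [nhds_prod_eq] at h
  exact h.mono_left (Filter.prod_mono le_rfl nhdsWithin_le_nhds)

lemma LocallyLipschitz.exists_eventually_abs_div_le (hψ : LocallyLipschitz ψ) (x : E) :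
    ∃ K : ℝ, ∀ v : E, ∀ᶠ p : E × ℝ in (nhds x) ×ˢ (nhdsWithin 0 (Set.Ioi (0 : ℝ))),
      |(ψ (p.1 + p.2 • v) - ψ p.1) / p.2| ≤ K * ‖v‖ := by
  obtain ⟨K, s, hs, hK⟩ := hψ x
  refine ⟨K, fun v => ?_⟩
  filter_upwards [eventually_pos_nhds_prod x, (tendsto_add_smul_nhds_prod x v).eventually hs,
    tendsto_fst.eventually hs] with p hp h1 h2
  have := hK.dist_le_mul _ h1 _ h2
  rw [Real.dist_eq, dist_eq_norm, add_sub_cancel_left, norm_smul, Real.norm_of_nonneg hp.le] at this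
  rw [abs_div, abs_of_pos hp, div_le_iff₀ hp]
  linarith

lemma LocallyLipschitz.eventually_lt_of_clarkeDeriv_lt (hψ : LocallyLipschitz ψ) {x v : E} {r : ℝ}
    (h : clarkeDeriv ψ x v < r) :
    ∀ᶠ p : E × ℝ in (nhds x) ×ˢ (nhdsWithin 0 (Set.Ioi (0 : ℝ))),
      (ψ (p.1 + p.2 • v) - ψ p.1) / p.2 < r := by
  obtain ⟨K, hK⟩ := hψ.exists_eventually_abs_div_le x
  exact eventually_lt_of_limsup_lt h
    (isBoundedUnder_of_eventually_le ((hK v).mono fun p hp => (abs_le.1 hp).2))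

lemma LocallyLipschitz.clarkeDeriv_le_of_eventually_le (hψ : LocallyLipschitz ψ) {x v : E} {r : ℝ}
    (h : ∀ᶠ p : E × ℝ in (nhds x) ×ˢ (nhdsWithin 0 (Set.Ioi (0 : ℝ))),
      (ψ (p.1 + p.2 • v) - ψ p.1) / p.2 ≤ r) :
    clarkeDeriv ψ x v ≤ r := by
  obtain ⟨K, hK⟩ := hψ.exists_eventually_abs_div_le x
  exact limsup_le_of_le (isBoundedUnder_of_eventually_ge
    ((hK v).mono fun p hp => (abs_le.1 hp).1)).isCoboundedUnder_le h

lemma LocallyLipschitz.clarkeDeriv_add_le (hψ : LocallyLipschitz ψ) (x v w : E) :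
    clarkeDeriv ψ x (v + w) ≤ clarkeDeriv ψ x v + clarkeDeriv ψ x w := by
  refine le_of_forall_pos_le_add fun ε hε => hψ.clarkeDeriv_le_of_eventually_le ?_
  have hv := hψ.eventually_lt_of_clarkeDeriv_lt (lt_add_of_pos_right (clarkeDeriv ψ x v) (half_pos hε))
  have hw := hψ.eventually_lt_of_clarkeDeriv_lt (lt_add_of_pos_right (clarkeDeriv ψ x w) (half_pos hε))
  have hw' := ((tendsto_add_smul_nhds_prod x v).prodMk
    (tendsto_snd (f := nhds x) (g := nhdsWithin 0 (Set.Ioi (0 : ℝ))))).eventually hw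
  filter_upwards [hv, hw'] with p h1 h2
  have : (ψ (p.1 + p.2 • (v + w)) - ψ p.1) / p.2 =
      (ψ (p.1 + p.2 • v + p.2 • w) - ψ (p.1 + p.2 • v)) / p.2
        + (ψ (p.1 + p.2 • v) - ψ p.1) / p.2 := by
    rw [smul_add, add_assoc]; ring
  linarith

lemma LocallyLipschitz.clarkeDeriv_smul_le (hψ : LocallyLipschitz ψ) {a : ℝ} (ha : 0 < a)
    (x v : E) : clarkeDeriv ψ x (a • v) ≤ a * clarkeDeriv ψ x v := by
  refine le_of_forall_pos_le_add fun ε hε => hψ.clarkeDeriv_le_of_eventually_le ?_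
  have hv := hψ.eventually_lt_of_clarkeDeriv_lt
    (lt_add_of_pos_right (clarkeDeriv ψ x v) (div_pos hε ha))
  have hmul : Tendsto (fun t : ℝ => t * a) (nhdsWithin 0 (Set.Ioi (0 : ℝ)))
      (nhdsWithin 0 (Set.Ioi (0 : ℝ))) := by
    refine tendsto_nhdsWithin_iff.2 ⟨?_, ?_⟩
    · have : Continuous fun t : ℝ => t * a := by fun_prop
      simpa using (this.tendsto 0).mono_left nhdsWithin_le_nhds
    · filter_upwards [self_mem_nhdsWithin] with t ht using mul_pos ht ha
  have hv' := (tendsto_id.prodMap hmul).eventually hv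
  filter_upwards [hv', eventually_pos_nhds_prod x] with p h1 hp
  simp only [Prod.map_fst, Prod.map_snd, id] at h1
  rw [div_lt_iff₀ (mul_pos hp ha)] at h1
  rw [div_le_iff₀ hp, smul_smul]
  have : (clarkeDeriv ψ x v + ε / a) * (p.2 * a) = (a * clarkeDeriv ψ x v + ε) * p.2 := by
    field_simp
  linarith

lemma LocallyLipschitz.clarkeDeriv_smul (hψ : LocallyLipschitz ψ) {a : ℝ} (ha : 0 < a)
    (x v : E) : clarkeDeriv ψ x (a • v) = a * clarkeDeriv ψ x v := by
  refine le_antisymm (hψ.clarkeDeriv_smul_le ha x v) ?_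
  have := hψ.clarkeDeriv_smul_le (inv_pos.2 ha) x (a • v)
  rw [smul_smul, inv_mul_cancel₀ ha.ne', one_smul, inv_mul_eq_div, le_div_iff₀ ha] at this
  linarith

lemma clarkeDeriv_zero (ψ : E → ℝ) (x : E) : clarkeDeriv ψ x 0 = 0 := by
  simp [clarkeDeriv]

/-- The Clarke directional derivative is the maximum of the Clarke subdifferential. -/
lemma LocallyLipschitz.exists_mem_clarkeSubdiff_apply_eq (hψ : LocallyLipschitz ψ) (x : E) {v : E}
    (hv : v ≠ 0) : ∃ ν ∈ clarkeSubdiff ψ x, ν v = clarkeDeriv ψ x v := by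
  obtain ⟨g, hg, hgle⟩ := exists_extension_of_le_sublinear
    (LinearPMap.mkSpanSingleton v (clarkeDeriv ψ x v) hv : E →ₗ.[ℝ] ℝ) (clarkeDeriv ψ x)
    (fun a ha w => hψ.clarkeDeriv_smul ha x w) (hψ.clarkeDeriv_add_le x) (by
      rintro ⟨y, hy⟩
      obtain ⟨a, rfl⟩ := Submodule.mem_span_singleton.1 hy
      rw [LinearPMap.mkSpanSingleton'_apply]
      simp only [RingHom.id_apply, smul_eq_mul]
      rcases lt_trichotomy a 0 with ha | rfl | ha
      · have h1 := hψ.clarkeDeriv_add_le x (a • v) ((-a) • v)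
        rw [neg_smul, add_neg_cancel, clarkeDeriv_zero, ← neg_smul,
          hψ.clarkeDeriv_smul (neg_pos.2 ha)] at h1
        linarith
      · simp [clarkeDeriv_zero]
      · rw [hψ.clarkeDeriv_smul ha])
  obtain ⟨K, hK⟩ := hψ.exists_eventually_abs_div_le x
  have hle (w : E) : g w ≤ K * ‖w‖ := (hgle w).trans
    (hψ.clarkeDeriv_le_of_eventually_le ((hK w).mono fun p hp => (abs_le.1 hp).2))
  refine ⟨g.mkContinuous K fun w => abs_le.2 ⟨?_, hle w⟩, hgle, ?_⟩
  · have := hle (-w)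
    rw [map_neg, norm_neg] at this
    linarith
  · have := hg ⟨v, Submodule.mem_span_singleton_self v⟩
    rw [LinearPMap.mkSpanSingleton_apply] at this
    exact this

lemma LocallyLipschitz.clarkeDeriv_le_mul_norm (hψ : LocallyLipschitz ψ) {x : E} {M : ℝ}
    (hM : ∀ ν ∈ clarkeSubdiff ψ x, ‖ν‖ ≤ M) (v : E) : clarkeDeriv ψ x v ≤ M * ‖v‖ := by
  rcases eq_or_ne v 0 with rfl | hv
  · simp [clarkeDeriv_zero]
  · obtain ⟨ν, hν, hνv⟩ := hψ.exists_mem_clarkeSubdiff_apply_eq x hv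
    rw [← hνv]
    exact ((le_abs_self _).trans (ν.le_opNorm v)).trans
      (mul_le_mul_of_nonneg_right (hM ν hν) (norm_nonneg v))

/-- A one-sided mean value inequality for locally Lipschitz functions. -/
lemma LocallyLipschitz.sub_le_of_clarkeDeriv_le (hψ : LocallyLipschitz ψ) {a v : E} {M : ℝ}
    (hM : ∀ s ∈ Set.Ico (0 : ℝ) 1, clarkeDeriv ψ (a + s • v) v ≤ M) :
    ψ (a + v) - ψ a ≤ M := by
  have hcont : Continuous fun s : ℝ => ψ (a + s • v) :=
    hψ.continuous.comp (by fun_prop)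
  have key := image_le_of_liminf_slope_right_le_deriv_boundary
    (f := fun s : ℝ => ψ (a + s • v)) (a := 0) (b := 1) hcont.continuousOn
    (B := fun s => ψ a + s * M) (B' := fun _ => M) (by simp) (by fun_prop)
    (fun s _ => by
      simpa using (((hasDerivAt_id s).mul_const M).const_add (ψ a)).hasDerivWithinAt)
    (fun s hs r hr => ?_) (Set.right_mem_Icc.2 zero_le_one)
  · simp only [one_smul, one_mul] at key
    linarith
  · have h1 := hψ.eventually_lt_of_clarkeDeriv_lt ((hM s hs).trans_lt hr)
    have ht : Tendsto (fun z : ℝ => (a + s • v, z - s)) (nhdsWithin s (Set.Ioi s))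
        ((nhds (a + s • v)) ×ˢ (nhdsWithin 0 (Set.Ioi (0 : ℝ)))) := by
      refine tendsto_const_nhds.prodMk (tendsto_nhdsWithin_iff.2 ⟨?_, ?_⟩)
      · have : Continuous fun z : ℝ => z - s := by fun_prop
        simpa using (this.tendsto s).mono_left nhdsWithin_le_nhds
      · filter_upwards [self_mem_nhdsWithin] with z hz using sub_pos.2 (Set.mem_Ioi.1 hz)
    refine Eventually.frequently ?_
    filter_upwards [ht.eventually h1] with z hz
    simp only [add_assoc, ← add_smul, add_sub_cancel] at hz
    rwa [slope_def_field]

lemma LocallyLipschitz.abs_sub_le_of_clarkeSubdiff_growth (hψ : LocallyLipschitz ψ) {c : ℝ}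
    (hc : 0 ≤ c) (hgrowth : ∀ ξ, ∀ ν ∈ clarkeSubdiff ψ ξ, ‖ν‖ ≤ c * (1 + ‖ξ‖)) (a v : E) :
    |ψ (a + v) - ψ a| ≤ c * (1 + ‖a‖ + ‖v‖) * ‖v‖ := by
  have hb (s : ℝ) (hs : s ∈ Set.Icc (0 : ℝ) 1) (w : E) (hw : ‖w‖ = ‖v‖) :
      clarkeDeriv ψ (a + s • v) w ≤ c * (1 + ‖a‖ + ‖v‖) * ‖v‖ := by
    refine (hψ.clarkeDeriv_le_mul_norm (hgrowth _) w).trans ?_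
    rw [hw, add_assoc]
    gcongr
    refine (norm_add_le _ _).trans ?_
    rw [norm_smul, Real.norm_of_nonneg hs.1]
    gcongr
    exact mul_le_of_le_one_left (norm_nonneg v) hs.2
  refine abs_le.2 ⟨?_, hψ.sub_le_of_clarkeDeriv_le fun s hs => hb s ⟨hs.1, hs.2.le⟩ v rfl⟩
  have := hψ.sub_le_of_clarkeDeriv_le (a := a + v) (v := -v)
    (M := c * (1 + ‖a‖ + ‖v‖) * ‖v‖) fun s hs => by
      have h := hb (1 - s) ⟨by linarith [hs.2], by linarith [hs.1]⟩ (-v) (norm_neg v)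
      rwa [sub_smul, one_smul, sub_eq_add_neg, ← add_assoc, ← smul_neg] at h
  rw [add_neg_cancel_right] at this
  linarith

end Clarke

lemma limsup_le_of_eventually_le_of_nonneg {α : Type*} {l : Filter α} {u : α → ℝ} {B : ℝ}
    (hB : 0 ≤ B) (h : ∀ᶠ a in l, u a ≤ B) : limsup u l ≤ B := by
  rw [limsup_eq]
  by_cases hb : BddBelow {a | ∀ᶠ n in l, u n ≤ a}
  · exact csInf_le hb h
  · rwa [Real.sInf_of_not_bddBelow hb]

section Integral

variable {X : Type*} [MeasurableSpace X] {μ : Measure X}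

lemma integral_mul_le_eLpNorm_mul_eLpNorm {f g : X → ℝ} (hf : MemLp f 2 μ) (hg : MemLp g 2 μ) :
    ∫ x, f x * g x ∂μ ≤ (eLpNorm f 2 μ).toReal * (eLpNorm g 2 μ).toReal := by
  rw [← Lp.norm_toLp f hf, ← Lp.norm_toLp g hg]
  refine le_of_eq_of_le ?_ (real_inner_le_norm _ _)
  rw [L2.inner_def]
  refine integral_congr_ae ?_
  filter_upwards [hf.coeFn_toLp, hg.coeFn_toLp] with x h1 h2
  simp [h1, h2, mul_comm]

lemma integral_norm_mul_norm_le {E : Type*} [NormedAddCommGroup E] (U V : Lp E 2 μ) :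
    ∫ x, ‖U x‖ * ‖V x‖ ∂μ ≤ ‖U‖ * ‖V‖ := by
  have := integral_mul_le_eLpNorm_mul_eLpNorm (Lp.memLp U).norm (Lp.memLp V).norm
  rwa [eLpNorm_norm, eLpNorm_norm, ← Lp.norm_def, ← Lp.norm_def] at this

variable {E : Type*} [NormedAddCommGroup E] [NormedSpace ℝ E] [MeasurableSpace E] [BorelSpace E]
  [SecondCountableTopology E] [IsFiniteMeasure μ] {f : X → E → ℝ} {c : ℝ}

lemma integrable_comp_of_clarkeSubdiff_growth (hmeas : ∀ ξ, Measurable fun x => f x ξ)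
    (hzero : Integrable (fun x => f x 0) μ) (hlip : ∀ x, LocallyLipschitz (f x)) (hc : 0 ≤ c)
    (hgrowth : ∀ x ξ, ∀ ν ∈ clarkeSubdiff (f x) ξ, ‖ν‖ ≤ c * (1 + ‖ξ‖))
    {w : X → E} (hw : MemLp w 2 μ) : Integrable (fun x => f x (w x)) μ := by
  have hm : Measurable (Function.uncurry fun ξ x => f x ξ) :=
    measurable_uncurry_of_continuous_of_measurable (fun x => (hlip x).continuous) hmeas
  have hwm : AEMeasurable (fun x => f x (w x)) μ :=
    hm.comp_aemeasurable (hw.1.aemeasurable.prodMk aemeasurable_id)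
  have hbound : Integrable (fun x => |f x 0| + c * (‖w x‖ + ‖w x‖ ^ 2)) μ :=
    hzero.abs.add (((hw.norm.integrable one_le_two).add hw.norm.integrable_sq).const_mul c)
  refine hbound.mono' hwm.aestronglyMeasurable (ae_of_all _ fun x => ?_)
  have h1 := (hlip x).abs_sub_le_of_clarkeSubdiff_growth hc (hgrowth x) 0 (w x)
  rw [zero_add, norm_zero, add_zero] at h1
  have h2 := abs_sub_abs_le_abs_sub (f x (w x)) (f x 0)
  rw [Real.norm_eq_abs]
  nlinarith

/-- If `g` dominates the Clarke derivatives of the integrands, then `∫ g` bounds the difference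
quotients of the integral functional on `L²` up to any `ε > 0`, by a Fatou type argument. -/
lemma eventually_integral_quotient_le (hmeas : ∀ ξ, Measurable fun x => f x ξ)
    (hzero : Integrable (fun x => f x 0) μ) (hlip : ∀ x, LocallyLipschitz (f x)) (hc : 0 ≤ c)
    (hgrowth : ∀ x ξ, ∀ ν ∈ clarkeSubdiff (f x) ξ, ‖ν‖ ≤ c * (1 + ‖ξ‖))
    (U V : Lp E 2 μ) {g : X → ℝ} (hg : Integrable g μ)
    (hle : ∀ᵐ x ∂μ, clarkeDeriv (f x) (U x) (V x) ≤ g x) {ε : ℝ} (hε : 0 < ε) :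
    ∀ᶠ p : Lp E 2 μ × ℝ in (nhds U) ×ˢ (nhdsWithin 0 (Set.Ioi (0 : ℝ))),
      ((∫ x, f x ((p.1 + p.2 • V : Lp E 2 μ) x) ∂μ) - ∫ x, f x (p.1 x) ∂μ) / p.2
        ≤ (∫ x, g x ∂μ) + ε := by
  by_contra hcon
  have hsmall : ∀ᶠ p : Lp E 2 μ × ℝ in (nhds U) ×ˢ (nhdsWithin 0 (Set.Ioi (0 : ℝ))), p.2 ≤ 1 :=
    tendsto_snd.eventually (nhdsWithin_le_nhds (Iic_mem_nhds zero_lt_one))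
  obtain ⟨q, hq, hqp⟩ := exists_seq_forall_of_frequently
    ((not_eventually.1 hcon).and_eventually ((eventually_pos_nhds_prod U).and hsmall))
  obtain ⟨ns, hns, hae⟩ :=
    (tendstoInMeasure_of_tendsto_Lp (tendsto_fst.comp hq)).exists_seq_tendsto_ae
  set W : ℕ → Lp E 2 μ := fun n => (q (ns n)).1
  set r : ℕ → ℝ := fun n => (q (ns n)).2
  replace hae : ∀ᵐ x ∂μ, Tendsto (fun n => W n x) atTop (nhds (U x)) := hae
  have hWU : Tendsto W atTop (nhds U) := (tendsto_fst.comp hq).comp hns.tendsto_atTop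
  have hr0 : Tendsto r atTop (nhdsWithin 0 (Set.Ioi 0)) :=
    (tendsto_snd.comp hq).comp hns.tendsto_atTop
  have hrpos (n : ℕ) : 0 < r n := (hqp (ns n)).2.1
  have hrle (n : ℕ) : r n ≤ 1 := (hqp (ns n)).2.2
  have hQ (n : ℕ) : (∫ x, g x ∂μ) + ε <
      ((∫ x, f x ((W n + r n • V : Lp E 2 μ) x) ∂μ) - ∫ x, f x (W n x) ∂μ) / r n :=
    not_le.1 (hqp (ns n)).1
  have hint (Z : Lp E 2 μ) : Integrable (fun x => f x (Z x)) μ :=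
    integrable_comp_of_clarkeSubdiff_growth hmeas hzero hlip hc hgrowth (Lp.memLp Z)
  have hmul (Y Z : Lp E 2 μ) : Integrable (fun x => ‖Y x‖ * ‖Z x‖) μ :=
    (Lp.memLp Y).norm.integrable_mul (Lp.memLp Z).norm
  have hadd : ∀ᵐ x ∂μ, ∀ n, (W n + r n • V : Lp E 2 μ) x = W n x + r n • V x := by
    refine ae_all_iff.2 fun n => ?_
    filter_upwards [Lp.coeFn_add (W n) (r n • V), Lp.coeFn_smul (r n) V] with x h1 h2
    rw [h1, Pi.add_apply, h2, Pi.smul_apply]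
  have hsub : ∀ᵐ x ∂μ, ∀ n, (W n - U : Lp E 2 μ) x = W n x - U x := by
    refine ae_all_iff.2 fun n => ?_
    filter_upwards [Lp.coeFn_sub (W n) U] with x h1
    rw [h1, Pi.sub_apply]
  set Q : ℕ → X → ℝ := fun n x =>
    (f x ((W n + r n • V : Lp E 2 μ) x) - f x (W n x)) / r n with hQdef
  set D : ℕ → X → ℝ := fun n x => c * (‖(W n - U : Lp E 2 μ) x‖ * ‖V x‖) with hD
  have hQint (n : ℕ) : Integrable (Q n) μ := ((hint _).sub (hint _)).div_const _
  have hDint (n : ℕ) : Integrable (D n) μ := (hmul _ _).const_mul c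
  have hRint (n : ℕ) : Integrable (fun x => max (Q n x - D n x - g x) 0) μ :=
    (((hQint n).sub (hDint n)).sub hg).pos_part
  have hlim : Tendsto (fun n => ∫ x, max (Q n x - D n x - g x) 0 ∂μ) atTop
      (nhds (∫ _, (0 : ℝ) ∂μ)) := by
    refine tendsto_integral_of_dominated_convergence
      (fun x => c * (‖V x‖ + ‖U x‖ * ‖V x‖ + ‖V x‖ * ‖V x‖) + |g x|)
      (fun n => (hRint n).1)
      ((((((Lp.memLp V).norm.integrable one_le_two).add (hmul U V)).add (hmul V V)).const_mul
        c).add hg.abs) (fun n => ?_) ?_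
    · filter_upwards [hadd, hsub] with x h1 h2
      have h3 := (hlip x).abs_sub_le_of_clarkeSubdiff_growth hc (hgrowth x) (W n x) (r n • V x)
      have h4 : Q n x ≤ c * (1 + (‖W n x - U x‖ + ‖U x‖) + ‖V x‖) * ‖V x‖ := by
        rw [hQdef]
        simp only [h1 n]
        rw [div_le_iff₀ (hrpos n)]
        refine ((le_abs_self _).trans h3).trans ?_
        rw [norm_smul, Real.norm_of_nonneg (hrpos n).le, mul_comm (r n) ‖V x‖, ← mul_assoc]
        have h5 : ‖W n x‖ ≤ ‖W n x - U x‖ + ‖U x‖ := by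
          simpa using norm_add_le (W n x - U x) (U x)
        have h6 : ‖V x‖ * r n ≤ ‖V x‖ := mul_le_of_le_one_right (norm_nonneg _) (hrle n)
        have := (hrpos n).le
        gcongr
      have h5 : D n x = c * (‖W n x - U x‖ * ‖V x‖) := by simp only [hD, h2 n]
      rw [Real.norm_of_nonneg (le_max_right _ _)]
      refine max_le ?_ (by positivity)
      have := neg_abs_le (g x)
      rw [h5]
      linarith
    · filter_upwards [hadd, hsub, hae, hle] with x h1 h2 h3 h4
      refine Metric.tendsto_nhds.2 fun δ hδ => ?_
      have hev := (hlip x).eventually_lt_of_clarkeDeriv_lt (h4.trans_lt (lt_add_of_pos_right _ hδ))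
      filter_upwards [(h3.prodMk hr0).eventually hev] with n hn
      rw [Real.dist_eq, sub_zero, abs_of_nonneg (le_max_right _ _)]
      refine max_lt ?_ hδ
      have h5 : Q n x < g x + δ := by simpa only [hQdef, h1 n] using hn
      have h6 : 0 ≤ D n x := by positivity
      linarith
  have hlimD : Tendsto (fun n => c * (‖W n - U‖ * ‖V‖)) atTop (nhds 0) := by
    have := ((tendsto_iff_norm_sub_tendsto_zero.1 hWU).mul_const ‖V‖).const_mul c
    simpa using this
  rw [integral_zero] at hlim
  have hsum := hlim.add hlimD
  rw [add_zero] at hsum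
  obtain ⟨n, hn⟩ := (hsum.eventually (gt_mem_nhds hε)).exists
  have h1 : ∫ x, Q n x ∂μ ≤ ∫ x, (max (Q n x - D n x - g x) 0 + D n x + g x) ∂μ := by
    refine integral_mono (hQint n) (((hRint n).add (hDint n)).add hg) fun x => ?_
    have := le_max_left (Q n x - D n x - g x) 0
    simp only
    linarith
  have h2 : ∫ x, (max (Q n x - D n x - g x) 0 + D n x + g x) ∂μ =
      (∫ x, max (Q n x - D n x - g x) 0 ∂μ) + (∫ x, D n x ∂μ) + ∫ x, g x ∂μ := by
    rw [← integral_add (hRint n) (hDint n)]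
    exact integral_add ((hRint n).add (hDint n)) hg
  have h3 : ∫ x, D n x ∂μ ≤ c * (‖W n - U‖ * ‖V‖) := by
    rw [hD, integral_const_mul]
    exact mul_le_mul_of_nonneg_left (integral_norm_mul_norm_le _ _) hc
  have h4 : ∫ x, Q n x ∂μ =
      ((∫ x, f x ((W n + r n • V : Lp E 2 μ) x) ∂μ) - ∫ x, f x (W n x) ∂μ) / r n := by
    rw [hQdef, integral_div, integral_sub (hint _) (hint _)]
  linarith [hQ n]

lemma clarkeDeriv_integral_le (hmeas : ∀ ξ, Measurable fun x => f x ξ)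
    (hzero : Integrable (fun x => f x 0) μ) (hlip : ∀ x, LocallyLipschitz (f x)) (hc : 0 ≤ c)
    (hgrowth : ∀ x ξ, ∀ ν ∈ clarkeSubdiff (f x) ξ, ‖ν‖ ≤ c * (1 + ‖ξ‖))
    (U V : Lp E 2 μ) {g : X → ℝ} (hg : Integrable g μ) (hg0 : 0 ≤ ∫ x, g x ∂μ)
    (hle : ∀ᵐ x ∂μ, clarkeDeriv (f x) (U x) (V x) ≤ g x) :
    clarkeDeriv (fun W : Lp E 2 μ => ∫ x, f x (W x) ∂μ) U V ≤ ∫ x, g x ∂μ :=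
  le_of_forall_pos_le_add fun _ hε => limsup_le_of_eventually_le_of_nonneg (by positivity)
    (eventually_integral_quotient_le hmeas hzero hlip hc hgrowth U V hg hle hε)

end Integral

/-- under hypotheses (i)–(iii) and the sign condition (iv)
`φ°(t,x,ξ;−ξ) ≤ d(1 + |ξ|)`, there exists `d' > 0` such that the integral functional
`Φ(t,U) = ∫_X φ(t,x,U(x)) dμ(x)` on `H = L²(X,μ;ℝ²)` satisfies
`Φ°(t,U;−U) ≤ d'(1 + ‖U‖_H)` for all `t ∈ (0,T)` and `U ∈ H`. -/
theorem stmt17 {X : Type*} [MeasurableSpace X] (μ : Measure X) [IsFiniteMeasure μ]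
    (T : ℝ) (hT : 0 < T)
    (φ : ℝ → X → EuclideanSpace ℝ (Fin 2) → ℝ)
    (h_meas : ∀ t ∈ Set.Ioo (0 : ℝ) T, ∀ ξ : EuclideanSpace ℝ (Fin 2),
      Measurable (fun x : X => φ t x ξ))
    (h_zero : ∀ t ∈ Set.Ioo (0 : ℝ) T, Integrable (fun x : X => φ t x 0) μ)
    (h_lip : ∀ t ∈ Set.Ioo (0 : ℝ) T, ∀ x : X, LocallyLipschitz (φ t x))
    (c : ℝ) (hc : 0 < c)
    (h_growth : ∀ t ∈ Set.Ioo (0 : ℝ) T, ∀ (x : X) (ξ : EuclideanSpace ℝ (Fin 2)),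
      ∀ ν ∈ clarkeSubdiff (φ t x) ξ, ‖ν‖ ≤ c * (1 + ‖ξ‖))
    (d : ℝ) (hd : 0 ≤ d)
    (h_sign : ∀ t ∈ Set.Ioo (0 : ℝ) T, ∀ (x : X) (ξ : EuclideanSpace ℝ (Fin 2)),
      clarkeDeriv (φ t x) ξ (-ξ) ≤ d * (1 + ‖ξ‖)) :
    ∃ d' : ℝ, 0 < d' ∧
      ∀ t ∈ Set.Ioo (0 : ℝ) T, ∀ U : Lp (EuclideanSpace ℝ (Fin 2)) 2 μ,
        clarkeDeriv
            (fun W : Lp (EuclideanSpace ℝ (Fin 2)) 2 μ => ∫ x, φ t x (W x) ∂μ) U (-U) ≤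
          d' * (1 + ‖U‖) := by
  set m : ℝ := (eLpNorm (fun _ : X => (1 : ℝ)) 2 μ).toReal
  have hm0 : 0 ≤ m := ENNReal.toReal_nonneg
  have hμ0 : 0 ≤ μ.real Set.univ := measureReal_nonneg
  refine ⟨d * (μ.real Set.univ + m) + 1, by positivity, fun t ht U => ?_⟩
  have hU : Integrable (fun x => ‖U x‖) μ := (Lp.memLp U).norm.integrable one_le_two
  have hg : Integrable (fun x => d * (1 + ‖U x‖)) μ := ((integrable_const _).add hU).const_mul d
  have hneg : ∀ᵐ x ∂μ, clarkeDeriv (φ t x) (U x) ((-U : Lp _ 2 μ) x) ≤ d * (1 + ‖U x‖) := by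
    filter_upwards [Lp.coeFn_neg U] with x hx
    rw [hx]
    exact h_sign t ht x (U x)
  refine (clarkeDeriv_integral_le (h_meas t ht) (h_zero t ht) (h_lip t ht) hc.le
    (h_growth t ht) U (-U) hg (integral_nonneg fun x => by positivity) hneg).trans ?_
  have hcs : ∫ x, ‖U x‖ ∂μ ≤ m * ‖U‖ := by
    have := integral_mul_le_eLpNorm_mul_eLpNorm (memLp_const (1 : ℝ)) (Lp.memLp U).norm
    simpa only [one_mul, eLpNorm_norm, ← Lp.norm_def] using this
  rw [integral_const_mul, integral_add (integrable_const _) hU, integral_const, smul_eq_mul,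
    mul_one]
  have h1 : d * (μ.real Set.univ + ∫ x, ‖U x‖ ∂μ) ≤ d * (μ.real Set.univ + m * ‖U‖) := by gcongr
  have h2 : 0 ≤ d * μ.real Set.univ * ‖U‖ := by positivity
  have h3 : 0 ≤ d * m := by positivity
  linarith [norm_nonneg U]
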